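/- Let B be a reduced affine algebra of dimension d over ℝ and X = Spec B. Let Q be a finitely generated projective B-module. Let J be the ideal of B defining the singular locus of B and let I ⊆ J be an ideal. Let (ã, q) ∈ Um(B ⊕ Q) be such that ã > 0 on X(ℝ) and ã ≡ 1 (mod I). Then there exists Φ ∈ E(B ⊕ Q) such that (ã, q)Φ = (b, q̃), where b > 0 on X(ℝ), the closed subscheme Z(b) of X is smooth of dimension ≤ d − 1 (i.e. for every prime ideal 𝔭 containing b, (B/bB)_𝔭 is a regular local ring of dimension ≤ d − 1), and q̃ ∈ IQ. -/

import Mathlib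

/-- An element `m` of an `R`-module `M` is *unimodular* if some linear functional maps it to `1`. -/
def IsUnimodular (R : Type*) {M : Type*} [CommRing R] [AddCommGroup M] [Module R M]
    (m : M) : Prop :=
  ∃ ψ : M →ₗ[R] R, ψ m = 1

/-- A *transvection* of the `R`-module `M`. -/
def IsTransvection {R M : Type*} [CommRing R] [AddCommGroup M] [Module R M]
    (τ : M ≃ₗ[R] M) : Prop :=
  ∃ (φ : M →ₗ[R] R) (p : M), φ p = 0 ∧ (IsUnimodular R φ ∨ IsUnimodular R p) ∧
    ∀ x : M, τ x = x + φ x • p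

/-- `E(M)`: the subgroup of `Aut_R(M)` generated by all transvections. -/
def transvectionSubgroup (R M : Type*) [CommRing R] [AddCommGroup M] [Module R M] :
    Subgroup (M ≃ₗ[R] M) :=
  Subgroup.closure {τ : M ≃ₗ[R] M | IsTransvection τ}

/-- A commutative ring is *regular local* if it is a Noetherian local ring whose maximal ideal
can be generated by (Krull dimension)-many elements. -/
def IsRegularLocal (R : Type*) [CommRing R] : Prop :=
  IsNoetherianRing R ∧ ∃ _h : IsLocalRing R, ∃ s : Finset R,
    Ideal.span (s : Set R) = IsLocalRing.maximalIdeal R ∧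
      (s.card : WithBot ℕ∞) = ringKrullDim R

open scoped TensorProduct

theorem exists_derivation_ne_zero {k K : Type*} [Field k] [CharZero k] [Field K] [Algebra k K]
    (g : K) (hg : Transcendental k g) : ∃ D : Derivation k K K, D g ≠ 0 := by
  have hs : AlgebraicIndepOn k id ({g} : Set K) := by
    have := (algebraicIndependent_unique_type_iff (R := k) (x := ((↑) : ({g} : Set K) → K))).2
      (by simpa using hg)
    exact this
  obtain ⟨s, hgs, hs⟩ := exists_isTranscendenceBasis_superset hs
  let i0 : s := ⟨g, hgs rfl⟩
  let S := MvPolynomial s k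
  let φ : S →ₐ[k] K := MvPolynomial.aeval ((↑) : s → K)
  have hφ : Function.Injective φ := hs.1
  let : Algebra S K := φ.toRingHom.toAlgebra
  have : IsScalarTower k S K := .of_algebraMap_eq' φ.comp_algebraMap.symm
  have : FaithfulSMul S K := (faithfulSMul_iff_algebraMap_injective S K).2 hφ
  have : CharZero S := charZero_of_injective_algebraMap (FaithfulSMul.algebraMap_injective k S)
  let F := FractionRing S
  let : Algebra F K := FractionRing.liftAlgebra S K
  have : IsScalarTower S F K := inferInstance
  have : Algebra.IsAlgebraic S K := by
    have h := hs.isAlgebraic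
    refine Algebra.IsAlgebraic.of_ringHom_of_comp_eq
      (hs.1.aevalEquiv : S →+* Algebra.adjoin k (Set.range ((↑) : s → K))) (RingHom.id K)
      hs.1.aevalEquiv.surjective Function.injective_id ?_
    exact RingHom.ext fun x ↦ hs.1.algebraMap_aevalEquiv x
  have : Algebra.IsAlgebraic F K := IsFractionRing.comap_isAlgebraic_iff.1 ‹Algebra.IsAlgebraic S K›
  have : Algebra.FormallyEtale F K := Algebra.FormallyEtale.of_isSeparable _ _
  have : Algebra.FormallyEtale S F := .of_isLocalization (nonZeroDivisors S)
  have : Algebra.FormallyEtale S K := .comp S F K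
  let e := KaehlerDifferential.tensorKaehlerEquivOfFormallyEtale k S K
  have he : e ((1 : K) ⊗ₜ KaehlerDifferential.D k S (MvPolynomial.X i0)) =
     KaehlerDifferential.D k K g := by
    have : algebraMap S K (MvPolynomial.X i0) = g := MvPolynomial.aeval_X _ _
    rw [← this, ← LinearEquiv.eq_symm_apply]
    exact (KaehlerDifferential.tensorKaehlerEquivOfFormallyEtale_symm_D_algebraMap k S K _).symm
  have hne : (1 : K) ⊗ₜ[S] KaehlerDifferential.D k S (MvPolynomial.X i0) ≠ 0 := by
    have := ((KaehlerDifferential.mvPolynomialBasis k s).baseChange K).ne_zero i0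
    simpa using this
  have hD : KaehlerDifferential.D k K g ≠ 0 := by
    rw [← he]
    simpa using hne
  have := mt (Module.forall_dual_apply_eq_zero_iff K (KaehlerDifferential.D k K g)).1 hD
  push Not at this
  obtain ⟨f, hf⟩ := this
  exact ⟨f.compDer (KaehlerDifferential.D k K), hf⟩

/-- Integral version at a prime: a derivation can be used to bound the bad locus. -/
theorem exists_bound_of_transcendental {A : Type*} [CommRing A] [Algebra ℝ A]
    [Algebra.FiniteType ℝ A] (g : A) (w : Ideal A) [w.IsPrime]
    (hg : Transcendental ℝ (algebraMap A w.ResidueField g)) :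
    ∃ h : A, h ∉ w ∧ ∀ (t : ℝ) (p : Ideal A), p.IsPrime → w ≤ p →
      (∃ s, s ∉ p ∧ s * (g - algebraMap ℝ A t) ∈ p ^ 2) → h ∈ p := by
  classical
  let K := w.ResidueField
  obtain ⟨D, hD⟩ := exists_derivation_ne_zero _ hg
  let ι := algebraMap A K
  have hι : ∀ x, ι x = 0 ↔ x ∈ w := fun x ↦ Ideal.algebraMap_residueField_eq_zero
  obtain ⟨G, hG⟩ := (inferInstance : Algebra.FiniteType ℝ A).out
  obtain ⟨c0, hc0⟩ := IsLocalization.exist_integer_multiples_of_finset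
    (nonZeroDivisors (A ⧸ w)) (G.image fun x ↦ D (ι x))
  obtain ⟨c, hc⟩ := Ideal.Quotient.mk_surjective c0.1
  have hcw : ι c ≠ 0 := by
    intro h
    have : (c0 : A ⧸ w) = 0 := by
      rw [← hc]; exact Ideal.Quotient.eq_zero_iff_mem.2 ((hι c).1 h)
    exact nonZeroDivisors.ne_zero c0.2 this
  have hint : ∀ a : A, ∃ b : A, ι b = ι c * D (ι a) := by
    intro a
    have ha : a ∈ Algebra.adjoin ℝ (G : Set A) := hG ▸ Algebra.mem_top
    induction ha using Algebra.adjoin_induction with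
    | mem x hx =>
      obtain ⟨y, hy⟩ := hc0 (D (ι x)) (Finset.mem_image_of_mem _ hx)
      obtain ⟨y, rfl⟩ := Ideal.Quotient.mk_surjective y
      refine ⟨y, ?_⟩
      rw [← hc, Algebra.smul_def] at hy
      exact hy
    | algebraMap r =>
      refine ⟨0, ?_⟩
      have : ι (algebraMap ℝ A r) = algebraMap ℝ K r :=
        (IsScalarTower.algebraMap_apply ℝ A K r).symm
      rw [this, D.map_algebraMap]; simp
    | add x y _ _ hx hy =>
      obtain ⟨x', hx⟩ := hx
      obtain ⟨y', hy⟩ := hy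
      exact ⟨x' + y', by simp [hx, hy, mul_add]⟩
    | mul x y _ _ hx hy =>
      obtain ⟨x', hx⟩ := hx
      obtain ⟨y', hy⟩ := hy
      refine ⟨x * y' + y * x', ?_⟩
      simp only [map_add, map_mul, hx, hy, D.leibniz, smul_eq_mul]; ring
  choose δ hδ using hint
  refine ⟨δ g, ?_, ?_⟩
  · rw [← hι, hδ]
    exact mul_ne_zero hcw hD
  · rintro t p hp hwp ⟨s, hs, hst⟩
    have key : ∀ z ∈ p ^ 2, δ z ∈ p := by
      have hsub : ∀ x y : A, ι x = ι y → y ∈ p → x ∈ p := by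
        intro x y hxy hy
        have : x - y ∈ w := by rw [← hι, map_sub, hxy, sub_self]
        simpa using p.add_mem (hwp this) hy
      intro z hz
      rw [pow_two] at hz
      induction hz using Submodule.mul_induction_on' with
      | mem_mul_mem x hx y hy =>
        refine hsub _ (x * δ y + y * δ x) ?_
          (p.add_mem (p.mul_mem_right _ hx) (p.mul_mem_right _ hy))
        simp only [map_add, map_mul, hδ, D.leibniz, smul_eq_mul]; ring
      | add x _ y _ hx hy =>
        refine hsub _ (δ x + δ y) ?_ (p.add_mem hx hy)
        simp only [map_add, hδ]; ring
    have h1 := key _ hst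
    have hgt : g - algebraMap ℝ A t ∈ p := by
      have := Ideal.pow_le_self two_ne_zero hst
      exact (hp.mem_or_mem this).resolve_left hs
    have h2 : δ (s * (g - algebraMap ℝ A t)) - (s * δ g + (g - algebraMap ℝ A t) * δ s) ∈ w := by
      rw [← hι]
      have : D (ι (algebraMap ℝ A t)) = 0 := by
        have : ι (algebraMap ℝ A t) = algebraMap ℝ K t :=
          (IsScalarTower.algebraMap_apply ℝ A K t).symm
        rw [this, D.map_algebraMap]
      simp only [map_add, map_sub, map_mul, hδ, D.leibniz, smul_eq_mul, this]; ring
    have h3 : s * δ g ∈ p := by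
      have := p.sub_mem (p.sub_mem h1 (hwp h2)) (p.mul_mem_right (δ s) hgt)
      convert! this using 1; ring
    exact (hp.mem_or_mem h3).resolve_left hs

/-- Algebraic Sard theorem for one function. -/
theorem algebraic_sard {A : Type*} [CommRing A] [Algebra ℝ A]
    [Algebra.FiniteType ℝ A] (g : A) :
    ∃ S : Set ℝ, S.Finite ∧ ∀ t, t ∉ S → ∀ p : Ideal A, p.IsPrime →
      ¬ ∃ s, s ∉ p ∧ s * (g - algebraMap ℝ A t) ∈ p ^ 2 := by
  have : IsNoetherianRing A := Algebra.FiniteType.isNoetherianRing ℝ A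
  suffices H : ∀ w : Ideal A, ∃ S : Set ℝ, S.Finite ∧ ∀ t, t ∉ S → ∀ p : Ideal A, p.IsPrime →
      w ≤ p → ¬ ∃ s, s ∉ p ∧ s * (g - algebraMap ℝ A t) ∈ p ^ 2 by
    obtain ⟨S, hS, h⟩ := H ⊥
    exact ⟨S, hS, fun t ht p hp ↦ h t ht p hp bot_le⟩
  intro w
  induction w using WellFoundedGT.induction with
  | ind w ih =>
  by_cases hw : w.IsPrime
  · by_cases hg : Transcendental ℝ (algebraMap A w.ResidueField g)
    · obtain ⟨h, hhw, hh⟩ := exists_bound_of_transcendental g w hg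
      have hlt : w < w ⊔ Ideal.span {h} := by
        refine lt_of_le_of_ne le_sup_left fun heq ↦ hhw ?_
        rw [heq]
        exact Ideal.mem_sup_right (Ideal.mem_span_singleton_self h)
      obtain ⟨S, hS, H⟩ := ih _ hlt
      refine ⟨S, hS, fun t ht p hp hwp hbad ↦ H t ht p hp ?_ hbad⟩
      exact sup_le hwp ((Ideal.span_singleton_le_iff_mem _).2 (hh t p hp hwp hbad))
    · obtain ⟨P, hP0, hP⟩ := not_not.1 hg
      refine ⟨P.rootSet ℝ, P.rootSet_finite ℝ, ?_⟩
      rintro t ht p hp hwp ⟨s, hs, hst⟩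
      apply ht
      rw [Polynomial.mem_rootSet]
      refine ⟨hP0, ?_⟩
      have hgt : g - algebraMap ℝ A t ∈ p := by
        have := Ideal.pow_le_self two_ne_zero hst
        exact (hp.mem_or_mem this).resolve_left hs
      rw [Polynomial.aeval_algebraMap_apply, Ideal.algebraMap_residueField_eq_zero] at hP
      have h1 := hwp hP
      by_contra hne
      have h2 : Polynomial.aeval g P - Polynomial.aeval (algebraMap ℝ A t) P ∈ p :=
        Ideal.mem_of_dvd p (by
          rw [Polynomial.aeval_def, Polynomial.aeval_def, Polynomial.eval₂_eq_eval_map,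
            Polynomial.eval₂_eq_eval_map]
          exact Polynomial.sub_dvd_eval_sub _ _ _) hgt
      have h3 : Polynomial.aeval (algebraMap ℝ A t) P ∈ p := by
        simpa using p.sub_mem h1 h2
      rw [Polynomial.aeval_algebraMap_apply] at h3
      exact hp.ne_top (Ideal.eq_top_of_isUnit_mem _ h3 ((isUnit_iff_ne_zero.2 hne).map _))
  · by_cases htop : w = ⊤
    · refine ⟨∅, Set.finite_empty, fun t _ p hp hwp ↦ ?_⟩
      exact absurd (top_le_iff.1 (htop ▸ hwp)) hp.ne_top
    · obtain ⟨x, hx, y, hy, hxy⟩ := (Ideal.not_isPrime_iff.1 hw).resolve_left htop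
      have hlt : ∀ h ∉ w, w < w ⊔ Ideal.span {h} := fun h hhw ↦ by
        refine lt_of_le_of_ne le_sup_left fun heq ↦ hhw ?_
        rw [heq]
        exact Ideal.mem_sup_right (Ideal.mem_span_singleton_self h)
      obtain ⟨S, hS, H⟩ := ih _ (hlt x hx)
      obtain ⟨S', hS', H'⟩ := ih _ (hlt y hy)
      refine ⟨S ∪ S', hS.union hS', fun t ht p hp hwp ↦ ?_⟩
      rcases hp.mem_or_mem (hwp hxy) with h | h
      · exact H t (fun h ↦ ht (.inl h)) p hp
          (sup_le hwp ((Ideal.span_singleton_le_iff_mem _).2 h))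
      · exact H' t (fun h ↦ ht (.inr h)) p hp
          (sup_le hwp ((Ideal.span_singleton_le_iff_mem _).2 h))

theorem isRegularLocal_quotient {R : Type*} [CommRing R] [IsLocalRing R]
    (hR : IsRegularLocal R) (b : R) (hb : b ∈ IsLocalRing.maximalIdeal R)
    (hb2 : b ∉ IsLocalRing.maximalIdeal R ^ 2) :
    IsRegularLocal (R ⧸ Ideal.span {b}) ∧
      ∃ n : ℕ, ringKrullDim R = (n + 1 : ℕ) ∧ ringKrullDim (R ⧸ Ideal.span {b}) = n := by
  classical
  obtain ⟨hN, _, s, hs, hcard⟩ := hR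
  have hmem : b ∈ Ideal.span (s : Set R) := hs ▸ hb
  obtain ⟨c, hc⟩ := (Submodule.mem_span_finset'.1 hmem)
  have hex : ∃ i : s, c i ∉ IsLocalRing.maximalIdeal R := by
    by_contra! hcon
    apply hb2
    rw [← hc, pow_two]
    refine Ideal.sum_mem _ fun i _ ↦ Ideal.mul_mem_mul (hcon i) ?_
    rw [← hs]
    exact Ideal.subset_span i.2
  obtain ⟨i, hi⟩ := hex
  have hiu : IsUnit (c i) := by simpa using hi
  set f := Ideal.Quotient.mk (Ideal.span {b})
  have hle : Ideal.span {b} ≤ IsLocalRing.maximalIdeal R :=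
    (Ideal.span_singleton_le_iff_mem _).2 hb
  have hnt : Nontrivial (R ⧸ Ideal.span {b}) := Ideal.Quotient.nontrivial_iff.2
    (fun h ↦ (IsLocalRing.maximalIdeal.isMaximal R).ne_top (top_le_iff.1 (h ▸ hle)))
  have hloc : IsLocalRing (R ⧸ Ideal.span {b}) :=
    IsLocalRing.of_surjective' f Ideal.Quotient.mk_surjective
  let s' := (s.erase i.1).image f
  have hfb : f b = 0 := Ideal.Quotient.eq_zero_iff_mem.2 (Ideal.mem_span_singleton_self b)
  have hmapm : (IsLocalRing.maximalIdeal R).map f = IsLocalRing.maximalIdeal (R ⧸ Ideal.span {b}) :=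
    IsLocalRing.map_maximalIdeal_of_surjective f Ideal.Quotient.mk_surjective
  have hspan : Ideal.span (s' : Set (R ⧸ Ideal.span {b})) =
      IsLocalRing.maximalIdeal (R ⧸ Ideal.span {b}) := by
    rw [← hmapm, ← hs, Ideal.map_span]
    apply le_antisymm
    · apply Ideal.span_mono
      rintro _ hx
      simp only [s', Finset.coe_image, Finset.coe_erase] at hx
      exact Set.image_mono Set.sdiff_subset hx
    · rw [Ideal.span_le]
      have hmem' : ∀ x ∈ s, x ≠ i.1 → f x ∈ Ideal.span (s' : Set (R ⧸ Ideal.span {b})) :=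
        fun x hx hxi ↦ Ideal.subset_span
          (Finset.mem_coe.2 (Finset.mem_image_of_mem _ (Finset.mem_erase.2 ⟨hxi, hx⟩)))
      rintro _ ⟨x, hx, rfl⟩
      by_cases hxi : x = i.1
      · subst hxi
        have h1 : f (c i) * f i.1 = - ∑ j ∈ Finset.univ.erase i, f (c j) * f j.1 := by
          rw [eq_neg_iff_add_eq_zero, Finset.add_sum_erase _ (fun j ↦ f (c j) * f j.1)
            (Finset.mem_univ i)]
          have h0 := congrArg f hc
          rw [hfb] at h0
          simpa using h0
        have h2 : f (c i) * f i.1 ∈ Ideal.span (s' : Set (R ⧸ Ideal.span {b})) := by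
          rw [h1]
          refine Ideal.neg_mem_iff _ |>.2 (Ideal.sum_mem _ fun j hj ↦ Ideal.mul_mem_left _ _ ?_)
          exact hmem' _ j.2 (fun h ↦ (Finset.mem_erase.1 hj).1 (Subtype.ext h))
        exact (Ideal.unit_mul_mem_iff_mem _ (hiu.map f)).1 h2
      · exact hmem' x hx hxi
  have hcs : s.card = (s.card - 1) + 1 := by
    have := Finset.card_pos.2 ⟨i.1, i.2⟩
    omega
  have hs'card : s'.card ≤ s.card - 1 := by
    rw [← Finset.card_erase_of_mem i.2]
    exact Finset.card_image_le
  have hNq : IsNoetherianRing (R ⧸ Ideal.span {b}) := inferInstance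
  have hup : ringKrullDim (R ⧸ Ideal.span {b}) ≤ s'.card := by
    refine (ringKrullDim_le_spanFinrank_maximalIdeal _).trans ?_
    rw [← hspan]
    have := Submodule.spanFinrank_span_le_ncard_of_finite (R := R ⧸ Ideal.span {b})
      (s := (s' : Set (R ⧸ Ideal.span {b}))) s'.finite_toSet
    rw [Set.ncard_coe_finset] at this
    exact_mod_cast this
  have hlow : ringKrullDim R ≤ ringKrullDim (R ⧸ Ideal.span {b}) + 1 := by
    have := ringKrullDim_le_ringKrullDim_quotient_add_card ({b} : Finset R) (by
      simpa [IsLocalRing.ringJacobson_eq_maximalIdeal] using hb)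
    rw [Finset.coe_singleton, Finset.card_singleton] at this
    exact_mod_cast this
  obtain ⟨n, hn⟩ : ∃ n : ℕ, ringKrullDim (R ⧸ Ideal.span {b}) = n := by
    have h0 : 0 ≤ ringKrullDim (R ⧸ Ideal.span {b}) := ringKrullDim_nonneg_of_nontrivial
    generalize ringKrullDim (R ⧸ Ideal.span {b}) = x at h0 hup
    induction x with
    | bot => simp at h0
    | coe x =>
      induction x with
      | top =>
        have h3 : (⊤ : ℕ∞) ≤ (s'.card : ℕ∞) := by exact_mod_cast hup
        simp at h3
      | coe n => exact ⟨n, rfl⟩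
  rw [hn] at hup hlow
  rw [← hcard] at hlow
  have h1 : n ≤ s'.card := by exact_mod_cast hup
  have h2 : s.card ≤ n + 1 := by exact_mod_cast hlow
  refine ⟨⟨hNq, hloc, s', hspan, ?_⟩, n, ?_, hn⟩
  · rw [hn]; congr 1; norm_cast; omega
  · rw [← hcard]; congr 1; norm_cast; omega

theorem IsRegularLocal.of_ringEquiv {R S : Type*} [CommRing R] [CommRing S] (e : R ≃+* S)
    (h : IsRegularLocal R) : IsRegularLocal S := by
  classical
  obtain ⟨hN, hl, s, hs, hc⟩ := h
  refine ⟨isNoetherianRing_of_ringEquiv R e, e.isLocalRing, s.image e, ?_, ?_⟩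
  · have := e.isLocalRing
    rw [← IsLocalRing.map_ringEquiv_maximalIdeal e, ← hs, Ideal.map_span]
    simp
  · rw [Finset.card_image_of_injective _ e.injective, hc, ringKrullDim_eq_of_ringEquiv e]

theorem regular_of_notMem_sq {B : Type*} [CommRing B] (d : ℕ) (hdim : ringKrullDim B = d)
    (b : B) (𝔮 : PrimeSpectrum (B ⧸ Ideal.span {b}))
    (hreg : IsRegularLocal (Localization.AtPrime
      (𝔮.asIdeal.comap (Ideal.Quotient.mk (Ideal.span {b})))))
    (hb : ¬ ∃ s, s ∉ 𝔮.asIdeal.comap (Ideal.Quotient.mk (Ideal.span {b})) ∧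
      s * b ∈ (𝔮.asIdeal.comap (Ideal.Quotient.mk (Ideal.span {b}))) ^ 2) :
    IsRegularLocal (Localization.AtPrime 𝔮.asIdeal) ∧
      ringKrullDim (Localization.AtPrime 𝔮.asIdeal) ≤ ((d - 1 : ℕ) : WithBot ℕ∞) := by
  set p := 𝔮.asIdeal.comap (Ideal.Quotient.mk (Ideal.span {b})) with hp
  let Bp := Localization.AtPrime p
  have hbp : b ∈ p := by
    rw [hp, Ideal.mem_comap, Ideal.Quotient.eq_zero_iff_mem.2 (Ideal.mem_span_singleton_self b)]
    exact zero_mem _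
  have h1 : algebraMap B Bp b ∈ IsLocalRing.maximalIdeal Bp :=
    (IsLocalization.AtPrime.to_map_mem_maximal_iff Bp p b).2 hbp
  have h2 : algebraMap B Bp b ∉ IsLocalRing.maximalIdeal Bp ^ 2 := by
    rw [← Localization.AtPrime.map_eq_maximalIdeal, ← Ideal.map_pow,
      IsLocalization.algebraMap_mem_map_algebraMap_iff p.primeCompl]
    rintro ⟨s, hs, h⟩
    exact hb ⟨s, hs, h⟩
  obtain ⟨hr, n, hn1, hn2⟩ := isRegularLocal_quotient hreg _ h1 h2
  have hspan : (Ideal.span {b}).map (algebraMap B Bp) = Ideal.span {algebraMap B Bp b} := by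
    rw [Ideal.map_span, Set.image_singleton]
  have hsub : Algebra.algebraMapSubmonoid (B ⧸ Ideal.span {b}) p.primeCompl =
      𝔮.asIdeal.primeCompl := by
    ext x
    obtain ⟨x, rfl⟩ := Ideal.Quotient.mk_surjective x
    constructor
    · rintro ⟨y, hy, hxy⟩
      rw [← hxy]
      exact hy
    · intro hx
      exact ⟨x, hx, rfl⟩
  have hloc : IsLocalization 𝔮.asIdeal.primeCompl
      (Bp ⧸ (Ideal.span {b}).map (algebraMap B Bp)) := by
    rw [← hsub]; infer_instance
  let e1 : (Bp ⧸ Ideal.span {algebraMap B Bp b}) ≃+* (Bp ⧸ (Ideal.span {b}).map (algebraMap B Bp)) :=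
    Ideal.quotEquivOfEq hspan.symm
  let e2 : (Bp ⧸ (Ideal.span {b}).map (algebraMap B Bp)) ≃+* Localization.AtPrime 𝔮.asIdeal :=
    (IsLocalization.algEquiv 𝔮.asIdeal.primeCompl _ _).toRingEquiv
  let e := e1.trans e2
  refine ⟨hr.of_ringEquiv e, ?_⟩
  rw [← ringKrullDim_eq_of_ringEquiv e, hn2]
  have hle : ringKrullDim Bp ≤ ringKrullDim B := by
    rw [IsLocalization.AtPrime.ringKrullDim_eq_height p Bp]
    exact Ideal.height_le_ringKrullDim_of_ne_top Ideal.IsPrime.ne_top'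
  rw [hn1, hdim] at hle
  have : n + 1 ≤ d := by exact_mod_cast hle
  have : n ≤ d - 1 := by omega
  exact_mod_cast this

theorem exists_mem_transvectionSubgroup {R M : Type*} [CommRing R] [AddCommGroup M] [Module R M]
    (φ : M →ₗ[R] R) (p : M) (h : φ p = 0) (hu : IsUnimodular R φ ∨ IsUnimodular R p) :
    ∃ τ ∈ transvectionSubgroup R M, ∀ x, τ x = x + φ x • p := by
  refine ⟨LinearEquiv.transvection h, Subgroup.subset_closure ⟨φ, p, h, hu, fun x ↦ ?_⟩,
    fun x ↦ ?_⟩ <;> simp [LinearMap.transvection.apply]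

/-- Let `B` be a reduced affine `ℝ`-algebra of dimension `d` (real points of `X = Spec B`
being identified with the `ℝ`-algebra homomorphisms `B → ℝ`), `Q` a finitely generated
projective `B`-module, `J` the ideal defining the singular locus of `B` and `I ⊆ J` an ideal.
If `(a', q) ∈ Um(B ⊕ Q)` with `a' > 0` on `X(ℝ)` and `a' ≡ 1 (mod I)`, then there is
`Φ ∈ E(B ⊕ Q)` with `(a', q)Φ = (b, q̃)`, `b > 0` on `X(ℝ)`, `Z(b)` smooth over `X` of
dimension `≤ d - 1`, and `q̃ ∈ IQ`. -/
theorem move_to_smooth_hypersurface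
    (B : Type*) [CommRing B] [Algebra ℝ B] [Algebra.FiniteType ℝ B] [IsReduced B]
    (d : ℕ) (hdim : ringKrullDim B = d)
    (Q : Type*) [AddCommGroup Q] [Module B Q] [Module.Finite B Q] [Module.Projective B Q]
    (J : Ideal B)
    (hJ : ∀ 𝔭 : PrimeSpectrum B,
      J ≤ 𝔭.asIdeal ↔ ¬ IsRegularLocal (Localization.AtPrime 𝔭.asIdeal))
    (I : Ideal B) (hIJ : I ≤ J)
    (a' : B) (q : Q) (hum : IsUnimodular B ((a', q) : B × Q))
    (hpos : ∀ φ : B →ₐ[ℝ] ℝ, 0 < φ a') (ha' : a' - 1 ∈ I) :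
    ∃ Φ ∈ transvectionSubgroup B (B × Q),
      (∀ φ : B →ₐ[ℝ] ℝ, 0 < φ (Φ (a', q)).1) ∧
      (∀ 𝔮 : PrimeSpectrum (B ⧸ Ideal.span {(Φ (a', q)).1}),
        IsRegularLocal (Localization.AtPrime 𝔮.asIdeal) ∧
          ringKrullDim (Localization.AtPrime 𝔮.asIdeal) ≤ ((d - 1 : ℕ) : WithBot ℕ∞)) ∧
      (Φ (a', q)).2 ∈ I • (⊤ : Submodule B Q) := by

  obtain ⟨ψ, hψ⟩ := hum
  -- the functional and the auxiliary elements
  set q' : Q := q - a' • q with hq'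
  set ψQ : Q →ₗ[B] B := ψ ∘ₗ LinearMap.inr B B Q with hψQ
  set f : B := ψQ q' with hf
  have hqI : q' ∈ I • (⊤ : Submodule B Q) := by
    have : q' = -((a' - 1) • q) := by rw [hq', sub_smul, one_smul, neg_sub]
    rw [this]
    exact Submodule.neg_mem _ (Submodule.smul_mem_smul ha' trivial)
  have hfI : f ∈ I := by
    have : f = -((a' - 1) * ψQ q) := by
      rw [hf, hq', map_sub, map_smul, smul_eq_mul]; ring
    rw [this]
    exact I.neg_mem (I.mul_mem_right _ ha')
  have hcomax : a' * (ψ (1, 0) + ψQ q) + f = 1 := by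
    have h1 : ((a', q) : B × Q) = a' • ((1, 0) : B × Q) + LinearMap.inr B B Q q := by
      ext <;> simp
    rw [h1, map_add, map_smul, smul_eq_mul] at hψ
    have h2 : ψ (LinearMap.inr B B Q q) = ψQ q := rfl
    rw [h2] at hψ
    rw [hf, hq', map_sub, map_smul, smul_eq_mul]
    linear_combination hψ
  -- choice of the parameter
  let A := Localization.Away f
  have : Algebra.FiniteType B A := IsLocalization.finiteType_of_monoid_fg (Submonoid.powers f) A
  have : Algebra.FiniteType ℝ A := Algebra.FiniteType.trans (S := B) inferInstance inferInstance
  let u : A := IsLocalization.Away.invSelf f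
  have hu : algebraMap B A f * u = 1 := IsLocalization.Away.mul_invSelf f
  obtain ⟨S, hS, hsard⟩ := algebraic_sard (-(algebraMap B A a' * u ^ 2))
  obtain ⟨t, ht0, htS⟩ := (Set.Ioi_infinite (0 : ℝ)).exists_notMem_finite hS
  set b : B := a' + algebraMap ℝ B t * f ^ 2 with hb
  -- the transvections
  obtain ⟨τ₁, hτ₁, h₁⟩ := exists_mem_transvectionSubgroup (LinearMap.fst B B Q) ((0, -q) : B × Q)
    (by simp) (Or.inl ⟨LinearMap.applyₗ ((1, 0) : B × Q), by simp⟩)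
  obtain ⟨τ₂, hτ₂, h₂⟩ := exists_mem_transvectionSubgroup
    ((algebraMap ℝ B t * f) • (ψQ ∘ₗ LinearMap.snd B B Q)) ((1, 0) : B × Q)
    (by simp) (Or.inr ⟨LinearMap.fst B B Q, by simp⟩)
  have hΦ : (τ₂ * τ₁) (a', q) = (b, q') := by
    rw [LinearEquiv.mul_apply, h₁, h₂]
    have : ((a', q) : B × Q) + LinearMap.fst B B Q (a', q) • ((0, -q) : B × Q) = (a', q') := by
      ext <;> simp [hq', sub_eq_add_neg]
    rw [this]
    ext
    · simp only [LinearMap.smul_apply, LinearMap.comp_apply, LinearMap.snd_apply, ← hf, hb,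
        Prod.fst_add, Prod.smul_fst, smul_eq_mul]
      ring
    · simp
  refine ⟨τ₂ * τ₁, mul_mem hτ₂ hτ₁, ?_⟩
  rw [hΦ]
  refine ⟨fun φ ↦ ?_, fun 𝔮 ↦ ?_, hqI⟩
  · have h1 : φ b = φ a' + t * φ f ^ 2 := by simp [hb]
    have h2 := hpos φ
    have h3 : 0 ≤ t * φ f ^ 2 := mul_nonneg (le_of_lt ht0) (sq_nonneg _)
    show 0 < φ b
    linarith
  · refine regular_of_notMem_sq d hdim b 𝔮 ?_ ?_
    all_goals
      set p := 𝔮.asIdeal.comap (Ideal.Quotient.mk (Ideal.span {b})) with hp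
      have hbp : b ∈ p := by
        rw [hp, Ideal.mem_comap,
          Ideal.Quotient.eq_zero_iff_mem.2 (Ideal.mem_span_singleton_self b)]
        exact zero_mem _
      have hpp : p.IsPrime := inferInstance
    · by_contra hcon
      have hJp := (hJ ⟨p, hpp⟩).2 hcon
      have hb1 : b - 1 ∈ I := by
        have : b - 1 = (a' - 1) + algebraMap ℝ B t * f * f := by rw [hb]; ring
        rw [this]
        exact I.add_mem ha' (I.mul_mem_left _ hfI)
      have := p.sub_mem hbp (hJp (hIJ hb1))
      rw [sub_sub_cancel] at this
      exact hpp.ne_top ((Ideal.eq_top_iff_one _).2 this)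
    · rintro ⟨s, hs, hsb⟩
      have hfp : f ∉ p := by
        intro hfp
        have hap : a' ∈ p := by
          have := p.sub_mem hbp (p.mul_mem_left (algebraMap ℝ B t * f) hfp)
          have h2 : b - algebraMap ℝ B t * f * f = a' := by rw [hb]; ring
          rwa [h2] at this
        apply hpp.ne_top
        rw [Ideal.eq_top_iff_one, ← hcomax]
        exact p.add_mem (p.mul_mem_right _ hap) hfp
      have hdisj : Disjoint (Submonoid.powers f : Set B) (p : Set B) :=
        (Ideal.disjoint_powers_iff_notMem f hpp.isRadical).2 hfp
      have hPP : (p.map (algebraMap B A)).IsPrime :=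
        IsLocalization.isPrime_of_isPrime_disjoint (Submonoid.powers f) A p hpp hdisj
      have hcomap : (p.map (algebraMap B A)).comap (algebraMap B A) = p :=
        IsLocalization.comap_map_of_isPrime_disjoint (Submonoid.powers f) A hpp hdisj
      refine hsard t htS _ hPP ⟨algebraMap B A (s * f ^ 2), ?_, ?_⟩
      · rw [← Ideal.mem_comap, hcomap]
        intro h
        rcases hpp.mem_or_mem h with h | h
        · exact hs h
        · exact hfp (hpp.mem_of_pow_mem _ h)
      · have h1 : algebraMap B A (s * b) ∈ (p.map (algebraMap B A)) ^ 2 := by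
          rw [← Ideal.map_pow]
          exact Ideal.mem_map_of_mem _ hsb
        have h2 : algebraMap B A (s * f ^ 2) *
            (-(algebraMap B A a' * u ^ 2) - algebraMap ℝ A t) = - algebraMap B A (s * b) := by
          have h3 : algebraMap B A (algebraMap ℝ B t) = algebraMap ℝ A t :=
            (IsScalarTower.algebraMap_apply ℝ B A t).symm
          rw [hb]
          simp only [map_mul, map_add, map_pow, h3]
          have h4 : algebraMap B A f ^ 2 * u ^ 2 = 1 := by rw [← mul_pow, hu, one_pow]
          linear_combination (-(algebraMap B A s) * algebraMap B A a') * h4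
        rw [h2]
        exact (Ideal.neg_mem_iff _).2 h1
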